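/- Let φ = (1 + √5)/2 be the golden mean, Fₙ the Fibonacci numbers (F₁ = F₂ = 1, Fₙ₊₁ = Fₙ + Fₙ₋₁), and for j ≥ 1 set A_j := (2π(φ^{2j} − φ^{−2j})/√5)·tan((π/2)·φ^{−2j}). Let N ≥ 1 be an integer, a > 0, b = a/φ, and let α < 0 satisfy −A_{N+1}/a ≤ α < −A_N/a. Then the set of positive integers m with (2mπ/a)·tan((π/2)·(⌈mφ⌉ − mφ)) < |α| is exactly {F₂, F₄, …, F_{2N}}, and no positive integer m satisfies (2mπ/b)·tan((π/2)·(⌈mφ⌉ − mφ)) < |α|; in particular, exactly N positive integers satisfy at least one of the two inequalities. -/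

import Mathlib

open Real

/-- `A j = (2π(φ^{2j} − φ^{−2j})/√5)·tan((π/2)·φ^{−2j})` for the golden mean `φ`. -/
noncomputable def goldenA (j : ℕ) : ℝ :=
  2 * π * (((1 + Real.sqrt 5) / 2) ^ (2 * (j : ℤ)) -
      ((1 + Real.sqrt 5) / 2) ^ (-(2 * (j : ℤ)))) / Real.sqrt 5 *
    Real.tan (π / 2 * ((1 + Real.sqrt 5) / 2) ^ (-(2 * (j : ℤ))))

open goldenRatio in
/-- The quantity `2πm · tan((π/2)(⌈mφ⌉ − mφ))` that decides whether `m` labels a gap. -/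
noncomputable def gapValue (m : ℕ) : ℝ :=
  2 * m * π * Real.tan (π / 2 * ((⌈(m : ℝ) * φ⌉ : ℝ) - (m : ℝ) * φ))

lemma hasDerivAt_inv_sub_mul_tan {y : ℝ} (hy : y ≠ 0) (hc : cos (π / 2 * y) ≠ 0) :
    HasDerivAt (fun y : ℝ => (y⁻¹ - y) * tan (π / 2 * y))
      ((-(y ^ 2)⁻¹ - 1) * tan (π / 2 * y) +
        (y⁻¹ - y) * (1 / cos (π / 2 * y) ^ 2 * (π / 2))) y := by
  have hlin : HasDerivAt (fun y : ℝ => π / 2 * y) (π / 2) y := by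
    simpa using (hasDerivAt_id y).const_mul (π / 2)
  exact ((hasDerivAt_inv hy).sub (hasDerivAt_id y)).mul ((hasDerivAt_tan hc).comp y hlin)

lemma one_sub_sq_mul_le_one_add_sq_mul_sin {y : ℝ} (hy : 0 ≤ y) (hy' : y ≤ 2 / 5) :
    (1 - y ^ 2) * (π * y) ≤ (1 + y ^ 2) * sin (π * y) := by
  have hπ := pi_pos
  have hπ2 : π ^ 2 ≤ 10 := by nlinarith [pi_lt_d2]
  have hy2 : y ^ 2 ≤ 4 / 25 := by nlinarith
  have hu : 0 ≤ π * y := by positivity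
  have hsin := sin_ge_sub_cube hu
  have hfactor : 0 ≤ 12 - π ^ 2 * (1 + y ^ 2) := by nlinarith [sq_nonneg y]
  have hnonneg : 0 ≤ π * y * y ^ 2 * (12 - π ^ 2 * (1 + y ^ 2)) := by positivity
  have hmul := mul_le_mul_of_nonneg_left hsin (by positivity : 0 ≤ 1 + y ^ 2)
  nlinarith

lemma antitoneOn_inv_sub_mul_tan :
    AntitoneOn (fun y : ℝ => (y⁻¹ - y) * tan (π / 2 * y)) (Set.Ioc 0 (2 / 5)) := by
  have hcos : ∀ y ∈ Set.Ioc (0 : ℝ) (2 / 5), 0 < cos (π / 2 * y) := fun y hy =>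
    cos_pos_of_mem_Ioo ⟨by nlinarith [pi_pos, hy.1], by nlinarith [pi_pos, hy.2]⟩
  refine antitoneOn_of_deriv_nonpos (convex_Ioc _ _) (fun y hy => ?_) (fun y hy => ?_)
    (fun y hy => ?_)
  · exact (hasDerivAt_inv_sub_mul_tan hy.1.ne' (hcos y hy).ne').continuousAt.continuousWithinAt
  · have hy := interior_subset hy
    exact (hasDerivAt_inv_sub_mul_tan hy.1.ne'
      (hcos y hy).ne').differentiableAt.differentiableWithinAt
  · have hy := interior_subset hy
    have hc := hcos y hy
    have hy0 := hy.1
    rw [(hasDerivAt_inv_sub_mul_tan hy.1.ne' hc.ne').deriv, tan_eq_sin_div_cos]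
    have hkey := one_sub_sq_mul_le_one_add_sq_mul_sin hy.1.le hy.2
    have hdouble : sin (π * y) = 2 * sin (π / 2 * y) * cos (π / 2 * y) := by
      rw [← sin_two_mul]; ring_nf
    rw [hdouble] at hkey
    have heq : (-(y ^ 2)⁻¹ - 1) * (sin (π / 2 * y) / cos (π / 2 * y)) +
        (y⁻¹ - y) * (1 / cos (π / 2 * y) ^ 2 * (π / 2)) =
        ((1 - y ^ 2) * (π * y) - (1 + y ^ 2) * (2 * sin (π / 2 * y) * cos (π / 2 * y))) /
          (2 * y ^ 2 * cos (π / 2 * y) ^ 2) := by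
      field_simp
      ring
    rw [heq]
    exact div_nonpos_of_nonpos_of_nonneg (by linarith) (by positivity)

lemma tendsto_inv_sub_mul_tan :
    Filter.Tendsto (fun y : ℝ => (y⁻¹ - y) * tan (π / 2 * y)) (nhdsWithin 0 (Set.Ioi 0))
      (nhds (π / 2)) := by
  have hlin : HasDerivAt (fun y : ℝ => π / 2 * y) (π / 2) 0 := by
    simpa using (hasDerivAt_id (0 : ℝ)).const_mul (π / 2)
  have htan : HasDerivAt (fun y : ℝ => tan (π / 2 * y)) (π / 2) 0 := by
    have hcomp := HasDerivAt.comp (0 : ℝ) (h₂ := tan) (hasDerivAt_tan (by simp)) hlin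
    simpa [Function.comp_def] using hcomp
  have hslope := htan.tendsto_slope_zero_right
  have hsq : Filter.Tendsto (fun y : ℝ => 1 - y ^ 2) (nhdsWithin 0 (Set.Ioi 0)) (nhds 1) := by
    have hcont : Continuous fun y : ℝ => 1 - y ^ 2 := by fun_prop
    simpa using (hcont.tendsto 0).mono_left nhdsWithin_le_nhds
  have hmul := hsq.mul hslope
  rw [one_mul] at hmul
  refine hmul.congr' ?_
  filter_upwards [self_mem_nhdsWithin] with y hy
  have hy' : y ≠ 0 := ne_of_gt hy
  simp only [zero_add, mul_zero, tan_zero, sub_zero, smul_eq_mul]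
  field_simp

lemma inv_sub_mul_tan_le {y : ℝ} (hy : y ∈ Set.Ioc (0 : ℝ) (2 / 5)) :
    (y⁻¹ - y) * tan (π / 2 * y) ≤ π / 2 := by
  refine ge_of_tendsto tendsto_inv_sub_mul_tan ?_
  filter_upwards [Ioo_mem_nhdsGT hy.1] with z hz
  exact antitoneOn_inv_sub_mul_tan ⟨hz.1, hz.2.le.trans hy.2⟩ hy hz.2.le

section Golden

open goldenRatio

lemma goldenConj_sq_le : ψ ^ 2 ≤ 2 / 5 := by
  have h5 : (11 / 5 : ℝ) ≤ √5 := Real.le_sqrt_of_sq_le (by norm_num)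
  rw [goldenConj_sq, goldenConj]
  linarith

lemma goldenConj_pow_even_mem {j : ℕ} (hj : 1 ≤ j) : ψ ^ (2 * j) ∈ Set.Ioc (0 : ℝ) (2 / 5) := by
  have hpos : 0 < ψ ^ 2 := sq_pos_of_neg goldenConj_neg
  rw [pow_mul]
  refine ⟨pow_pos hpos j, ?_⟩
  calc (ψ ^ 2) ^ j ≤ (ψ ^ 2) ^ 1 :=
        pow_le_pow_of_le_one hpos.le (goldenConj_sq_le.trans (by norm_num)) hj
    _ ≤ 2 / 5 := by rw [pow_one]; exact goldenConj_sq_le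

lemma goldenRatio_zpow_neg_even (j : ℕ) : φ ^ (-(2 * (j : ℤ))) = ψ ^ (2 * j) := by
  rw [zpow_neg, ← inv_zpow, inv_goldenRatio]
  have hcast : (2 * (j : ℤ)) = ((2 * j : ℕ) : ℤ) := by push_cast; ring
  rw [hcast, zpow_natCast, Even.neg_pow (even_two_mul j)]

lemma goldenA_eq (j : ℕ) :
    goldenA j = 2 * π / √5 *
      (((ψ ^ (2 * j))⁻¹ - ψ ^ (2 * j)) * tan (π / 2 * ψ ^ (2 * j))) := by
  have hinv : φ ^ (2 * (j : ℤ)) = (ψ ^ (2 * j))⁻¹ := by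
    rw [← goldenRatio_zpow_neg_even, zpow_neg, inv_inv]
  rw [← hinv, ← goldenRatio_zpow_neg_even, goldenA]
  ring

lemma goldenA_le_goldenA {i j : ℕ} (hi : 1 ≤ i) (hij : i ≤ j) : goldenA i ≤ goldenA j := by
  rw [goldenA_eq, goldenA_eq]
  refine mul_le_mul_of_nonneg_left ?_ (by positivity)
  refine antitoneOn_inv_sub_mul_tan (goldenConj_pow_even_mem (hi.trans hij))
    (goldenConj_pow_even_mem hi) ?_
  rw [pow_mul, pow_mul]
  exact pow_le_pow_of_le_one (sq_nonneg ψ) (goldenConj_sq_le.trans (by norm_num)) hij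

lemma goldenA_le_pi_sq_div {j : ℕ} (hj : 1 ≤ j) : goldenA j ≤ π ^ 2 / √5 := by
  rw [goldenA_eq]
  calc _ ≤ 2 * π / √5 * (π / 2) :=
        mul_le_mul_of_nonneg_left (inv_sub_mul_tan_le (goldenConj_pow_even_mem hj))
          (by positivity)
    _ = π ^ 2 / √5 := by ring

lemma gapValue_fib_even {j : ℕ} (hj : 1 ≤ j) : gapValue (Nat.fib (2 * j)) = goldenA j := by
  have hmem := goldenConj_pow_even_mem hj
  have hfib := fib_succ_sub_goldenRatio_mul_fib (2 * j)
  have hceil : ⌈(Nat.fib (2 * j) : ℝ) * φ⌉ = (Nat.fib (2 * j + 1) : ℤ) := by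
    rw [Int.ceil_eq_iff]
    push_cast
    exact ⟨by linarith [hmem.2], by linarith [hmem.1]⟩
  have hpow : φ ^ (2 * j) = (ψ ^ (2 * j))⁻¹ := by
    rw [← inv_pow, inv_goldenConj, Even.neg_pow (even_two_mul j)]
  rw [gapValue, goldenA_eq, hceil, ← hpow]
  have hdelta : (((Nat.fib (2 * j + 1) : ℕ) : ℤ) : ℝ) - (Nat.fib (2 * j) : ℝ) * φ
      = ψ ^ (2 * j) := by
    push_cast
    linarith
  rw [hdelta, coe_fib_eq (2 * j)]
  ring

/-- The solutions of `p² - pm - m² = 1` in natural numbers are consecutive Fibonacci numbers. -/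
lemma exists_fib_of_sq_eq (m : ℕ) :
    ∀ p : ℕ, p ^ 2 = p * m + m ^ 2 + 1 → ∃ j, m = Nat.fib (2 * j) ∧ p = Nat.fib (2 * j + 1) := by
  induction m using Nat.strong_induction_on with
  | _ m ih =>
    intro p hp
    rcases Nat.eq_zero_or_pos m with rfl | hm
    · exact ⟨0, by simp, by simpa using hp⟩
    have hmp : m < p := by nlinarith
    have hpm : p ≤ 2 * m := by nlinarith
    obtain ⟨s, rfl⟩ := Nat.exists_eq_add_of_lt hmp
    obtain ⟨t, rfl⟩ : ∃ t, m = s + 1 + t := ⟨m - (s + 1), by omega⟩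
    obtain ⟨j, hj, hj'⟩ := ih t (by omega) (s + 1) (by nlinarith)
    refine ⟨j + 1, ?_, ?_⟩
    · rw [show 2 * (j + 1) = 2 * j + 2 by ring, Nat.fib_add_two, ← hj, ← hj']
      ring
    · rw [show 2 * (j + 1) + 1 = 2 * j + 1 + 2 by ring, Nat.fib_add_two,
        show 2 * j + 1 + 1 = 2 * j + 2 by ring, Nat.fib_add_two, ← hj, ← hj']
      ring

lemma ceil_sub_mul_goldenRatio_mem {m : ℕ} (hm : 0 < m) :
    (⌈(m : ℝ) * φ⌉ : ℝ) - m * φ ∈ Set.Ioo (0 : ℝ) 1 := by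
  have hirr : Irrational ((m : ℝ) * φ) := goldenRatio_irrational.natCast_mul hm.ne'
  refine ⟨sub_pos.2 ((Int.le_ceil _).lt_of_ne (hirr.ne_int _)), ?_⟩
  linarith [Int.ceil_lt_add_one ((m : ℝ) * φ)]

lemma sub_mul_goldenRatio_norm (p m : ℝ) :
    (p - m * φ) ^ 2 + √5 * (m * (p - m * φ)) = p ^ 2 - p * m - m ^ 2 := by
  have hsqrt : √5 = 2 * φ - 1 := by rw [goldenRatio]; ring
  rw [hsqrt]
  linear_combination m ^ 2 * (-1) * goldenRatio_sq

lemma one_le_norm_ceil {m : ℕ} (hm : 0 < m) :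
    1 ≤ ⌈(m : ℝ) * φ⌉ ^ 2 - ⌈(m : ℝ) * φ⌉ * m - (m : ℤ) ^ 2 := by
  have hδ := (ceil_sub_mul_goldenRatio_mem hm).1
  have hnorm := sub_mul_goldenRatio_norm ⌈(m : ℝ) * φ⌉ m
  have hpos : (0 : ℝ) < (⌈(m : ℝ) * φ⌉ : ℝ) ^ 2 - ⌈(m : ℝ) * φ⌉ * m - (m : ℝ) ^ 2 := by
    rw [← hnorm]; positivity
  have hposInt : 0 < ⌈(m : ℝ) * φ⌉ ^ 2 - ⌈(m : ℝ) * φ⌉ * m - (m : ℤ) ^ 2 := by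
    exact_mod_cast hpos
  omega

lemma one_le_sqrt_five_mul_of_not_fib {m : ℕ} (hm : 0 < m)
    (hfib : ∀ j, 1 ≤ j → m ≠ Nat.fib (2 * j)) :
    1 ≤ √5 * (m * ((⌈(m : ℝ) * φ⌉ : ℝ) - m * φ)) := by
  obtain ⟨hδ0, hδ1⟩ := ceil_sub_mul_goldenRatio_mem hm
  have hnorm := sub_mul_goldenRatio_norm ⌈(m : ℝ) * φ⌉ m
  have hge := one_le_norm_ceil hm
  have hne : ⌈(m : ℝ) * φ⌉ ^ 2 - ⌈(m : ℝ) * φ⌉ * m - (m : ℤ) ^ 2 ≠ 1 := by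
    intro heq
    obtain ⟨p, hp⟩ := Int.eq_ofNat_of_zero_le
      (Int.ceil_nonneg (by positivity : 0 ≤ (m : ℝ) * φ))
    rw [hp] at heq
    obtain ⟨j, hj, -⟩ := exists_fib_of_sq_eq m p (by zify; linarith)
    rcases Nat.eq_zero_or_pos j with rfl | hj0
    · simp at hj; omega
    · exact hfib j hj0 hj
  have htwo : 2 ≤ ⌈(m : ℝ) * φ⌉ ^ 2 - ⌈(m : ℝ) * φ⌉ * m - (m : ℤ) ^ 2 := by omega
  have htwo' : (2 : ℝ) ≤ (⌈(m : ℝ) * φ⌉ : ℝ) ^ 2 - ⌈(m : ℝ) * φ⌉ * m - (m : ℝ) ^ 2 := by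
    exact_mod_cast htwo
  nlinarith

lemma one_le_goldenRatio_mul_sqrt_five_mul {m : ℕ} (hm : 0 < m) :
    1 ≤ φ * (√5 * (m * ((⌈(m : ℝ) * φ⌉ : ℝ) - m * φ))) := by
  obtain ⟨hδ0, hδ1⟩ := ceil_sub_mul_goldenRatio_mem hm
  have hnorm := sub_mul_goldenRatio_norm ⌈(m : ℝ) * φ⌉ m
  have hge : (1 : ℝ) ≤ (⌈(m : ℝ) * φ⌉ : ℝ) ^ 2 - ⌈(m : ℝ) * φ⌉ * m - (m : ℝ) ^ 2 := by
    exact_mod_cast one_le_norm_ceil hm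
  set δ : ℝ := (⌈(m : ℝ) * φ⌉ : ℝ) - m * φ with hδ
  have h5 : (11 / 5 : ℝ) ≤ √5 := Real.le_sqrt_of_sq_le (by norm_num)
  have hφ : (3 / 2 : ℝ) ≤ φ := by rw [goldenRatio]; linarith
  have hm1 : (1 : ℝ) ≤ m := by exact_mod_cast hm
  suffices h : 2 / 3 ≤ √5 * (m * δ) by nlinarith
  by_contra! hlt
  have hδm : δ ≤ m * δ := by nlinarith
  have hδle : δ < 1 / 3 := by nlinarith
  nlinarith

lemma pi_sq_mul_le_gapValue {m : ℕ} (hm : 0 < m) :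
    π ^ 2 / √5 * (√5 * (m * ((⌈(m : ℝ) * φ⌉ : ℝ) - m * φ))) ≤ gapValue m := by
  obtain ⟨hδ0, hδ1⟩ := ceil_sub_mul_goldenRatio_mem hm
  have hπ := pi_pos
  have htan := le_tan (x := π / 2 * ((⌈(m : ℝ) * φ⌉ : ℝ) - m * φ)) (by positivity) (by nlinarith)
  calc _ = 2 * m * π * (π / 2 * ((⌈(m : ℝ) * φ⌉ : ℝ) - m * φ)) := by
        field_simp
    _ ≤ gapValue m := mul_le_mul_of_nonneg_left htan (by positivity)

lemma pi_sq_div_le_gapValue_of_not_fib {m : ℕ} (hm : 0 < m)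
    (hfib : ∀ j, 1 ≤ j → m ≠ Nat.fib (2 * j)) : π ^ 2 / √5 ≤ gapValue m :=
  (le_mul_of_one_le_right (by positivity) (one_le_sqrt_five_mul_of_not_fib hm hfib)).trans
    (pi_sq_mul_le_gapValue hm)

lemma pi_sq_div_le_goldenRatio_mul_gapValue {m : ℕ} (hm : 0 < m) :
    π ^ 2 / √5 ≤ φ * gapValue m := by
  calc π ^ 2 / √5
      ≤ π ^ 2 / √5 * (φ * (√5 * (m * ((⌈(m : ℝ) * φ⌉ : ℝ) - m * φ)))) :=
        le_mul_of_one_le_right (by positivity) (one_le_goldenRatio_mul_sqrt_five_mul hm)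
    _ = φ * (π ^ 2 / √5 * (√5 * (m * ((⌈(m : ℝ) * φ⌉ : ℝ) - m * φ)))) := by ring
    _ ≤ φ * gapValue m :=
        mul_le_mul_of_nonneg_left (pi_sq_mul_le_gapValue hm) goldenRatio_pos.le

lemma gapValue_lt_iff {N m : ℕ} (hm : 0 < m) {c : ℝ} (hlow : goldenA N < c)
    (hhigh : c ≤ goldenA (N + 1)) :
    gapValue m < c ↔ ∃ j : ℕ, 1 ≤ j ∧ j ≤ N ∧ m = Nat.fib (2 * j) := by
  constructor
  · intro hlt
    by_cases hfib : ∀ j, 1 ≤ j → m ≠ Nat.fib (2 * j)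
    · have hbound := pi_sq_div_le_gapValue_of_not_fib hm hfib
      have hA := goldenA_le_pi_sq_div (Nat.le_add_left 1 N)
      linarith
    · push Not at hfib
      obtain ⟨j, hj, rfl⟩ := hfib
      refine ⟨j, hj, ?_, rfl⟩
      by_contra! hNj
      rw [gapValue_fib_even hj] at hlt
      have hA := goldenA_le_goldenA (Nat.le_add_left 1 N) (Nat.succ_le_of_lt hNj)
      linarith
  · rintro ⟨j, hj, hjN, rfl⟩
    rw [gapValue_fib_even hj]
    exact (goldenA_le_goldenA hj hjN).trans_lt hlow

lemma ncard_fib_even (N : ℕ) :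
    {m : ℕ | ∃ j : ℕ, 1 ≤ j ∧ j ≤ N ∧ m = Nat.fib (2 * j)}.ncard = N := by
  have himage : {m : ℕ | ∃ j : ℕ, 1 ≤ j ∧ j ≤ N ∧ m = Nat.fib (2 * j)} =
      (fun j => Nat.fib (2 * j)) '' (Finset.Icc 1 N : Finset ℕ) := by
    ext m
    simp [and_assoc, eq_comm]
  have hinj : Set.InjOn (fun j => Nat.fib (2 * j)) (Finset.Icc 1 N : Finset ℕ) := by
    intro i hi j hj hij
    simp only [Finset.coe_Icc, Set.mem_Icc] at hi hj
    have heq := Nat.fib_strictMonoOn.injOn (Set.mem_Ici.2 (by omega : 2 ≤ 2 * i))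
      (Set.mem_Ici.2 (by omega : 2 ≤ 2 * j)) hij
    omega
  rw [himage, hinj.ncard_image, Set.ncard_coe_finset]
  simp

end Golden

theorem golden_mean_exactly_N_gaps (N : ℕ) (hN : 1 ≤ N) (a b α : ℝ) (ha : 0 < a)
    (hb : b = a / ((1 + Real.sqrt 5) / 2)) (hα : α < 0)
    (hlow : -goldenA (N + 1) / a ≤ α) (hhigh : α < -goldenA N / a) :
    -- the a-gap condition holds exactly for m = F₂, F₄, …, F_{2N}
    {m : ℕ | 0 < m ∧
        (2 * m * π / a) * Real.tan (π / 2 *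
            ((⌈(m : ℝ) * ((1 + Real.sqrt 5) / 2)⌉ : ℝ) -
              (m : ℝ) * ((1 + Real.sqrt 5) / 2))) < |α|}
      = {m : ℕ | ∃ j : ℕ, 1 ≤ j ∧ j ≤ N ∧ m = Nat.fib (2 * j)} ∧
    -- the b-gap condition holds for no positive integer m
    (∀ m : ℕ, 0 < m →
      ¬ (2 * m * π / b) * Real.tan (π / 2 *
          ((⌈(m : ℝ) * ((1 + Real.sqrt 5) / 2)⌉ : ℝ) -
            (m : ℝ) * ((1 + Real.sqrt 5) / 2))) < |α|) ∧
    -- in particular there are exactly N gaps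
    {m : ℕ | 0 < m ∧
        ((2 * m * π / a) * Real.tan (π / 2 *
            ((⌈(m : ℝ) * ((1 + Real.sqrt 5) / 2)⌉ : ℝ) -
              (m : ℝ) * ((1 + Real.sqrt 5) / 2))) < |α| ∨
          (2 * m * π / b) * Real.tan (π / 2 *
            ((⌈(m : ℝ) * ((1 + Real.sqrt 5) / 2)⌉ : ℝ) -
              (m : ℝ) * ((1 + Real.sqrt 5) / 2))) < |α|)}.ncard = N := by
  have hφ := goldenRatio_pos
  have hbpos : 0 < b := hb ▸ div_pos ha hφ
  have hc : goldenA N < |α| * a := by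
    rw [abs_of_neg hα]
    have := (lt_div_iff₀ ha).1 hhigh
    linarith
  have hc' : |α| * a ≤ goldenA (N + 1) := by
    rw [abs_of_neg hα]
    have := (div_le_iff₀ ha).1 hlow
    linarith
  have hgapA : ∀ m : ℕ, (2 * m * π / a) * Real.tan (π / 2 *
      ((⌈(m : ℝ) * ((1 + Real.sqrt 5) / 2)⌉ : ℝ) -
        (m : ℝ) * ((1 + Real.sqrt 5) / 2))) < |α| ↔ gapValue m < |α| * a := by
    intro m
    rw [← div_lt_iff₀ ha, gapValue, div_mul_eq_mul_div]
  have hgapB : ∀ m : ℕ, 0 < m → ¬ (2 * m * π / b) * Real.tan (π / 2 *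
      ((⌈(m : ℝ) * ((1 + Real.sqrt 5) / 2)⌉ : ℝ) -
        (m : ℝ) * ((1 + Real.sqrt 5) / 2))) < |α| := by
    intro m hm hlt
    rw [div_mul_eq_mul_div, div_lt_iff₀ hbpos, hb,
      ← mul_div_assoc |α| a, lt_div_iff₀ hφ] at hlt
    change gapValue m * goldenRatio < |α| * a at hlt
    have hbound := pi_sq_div_le_goldenRatio_mul_gapValue hm
    have hA := goldenA_le_pi_sq_div (Nat.le_add_left 1 N)
    linarith
  have hset : {m : ℕ | 0 < m ∧
        (2 * m * π / a) * Real.tan (π / 2 *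
            ((⌈(m : ℝ) * ((1 + Real.sqrt 5) / 2)⌉ : ℝ) -
              (m : ℝ) * ((1 + Real.sqrt 5) / 2))) < |α|}
      = {m : ℕ | ∃ j : ℕ, 1 ≤ j ∧ j ≤ N ∧ m = Nat.fib (2 * j)} := by
    ext m
    simp only [Set.mem_ofPred_eq]
    rw [hgapA]
    constructor
    · rintro ⟨hm, hlt⟩
      exact (gapValue_lt_iff hm hc hc').1 hlt
    · rintro ⟨j, hj, hjN, rfl⟩
      have hpos : 0 < Nat.fib (2 * j) := Nat.fib_pos.2 (by omega)
      exact ⟨hpos, (gapValue_lt_iff hpos hc hc').2 ⟨j, hj, hjN, rfl⟩⟩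
  refine ⟨hset, hgapB, ?_⟩
  rw [← ncard_fib_even N, ← hset]
  congr 1
  ext m
  simp only [Set.mem_ofPred_eq]
  exact and_congr_right fun hm => or_iff_left (hgapB m hm)
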